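/- arXiv:2405.04391 — 2 statements merged into one kernel-verified Lean document; each statement's English description precedes it below -/
import Mathlib

section
/- Let p be a prime, let S be a subset of 𝔽_p with |S| ≥ 2, and let 1 ≤ r ≤ p − 1 be an integer. Then there exist constants a > 0 and C > 0 (depending only on p, S and r) such that the following holds for every n and every integer k ≥ 3: if E₁, …, E_k are strict subsets of 𝔽_p each of size at most r, and φ₁, …, φ_k : 𝔽_p^n → 𝔽_p are mod-p forms satisfying |Z(φ_j − φ_i)| ≥ 2·⌊(r−1)/(|S|−1)⌋ + 1 for all 1 ≤ i < j ≤ k, then the density inside S^n of the set {x ∈ S^n : φ₁(x) ∈ E₁, …, φ_k(x) ∈ E_k} is at most C · k^{−a/log log k} (natural logarithms). -/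
open Finset

/-- The support of a mod-p form given by its coefficient vector. -/
def supp {p n : ℕ} (φ : Fin n → ZMod p) : Finset (Fin n) :=
  Finset.univ.filter fun i => φ i ≠ 0

/-- Evaluation of a mod-p form (given by coefficients) at a point. -/
def evalForm {p n : ℕ} (φ x : Fin n → ZMod p) : ZMod p := ∑ i, φ i * x i

/-- The sumset a₁S + ⋯ + a_mS. -/
def sumsetSub {p m : ℕ} (a : Fin m → ZMod p) (S : Finset (ZMod p)) : Finset (ZMod p) :=
  (Fintype.piFinset fun _ : Fin m => S).image fun s => ∑ i, a i * s i

/-- L(S,E): smallest L such that for all nonzero a₁,…,a_L the sumset a₁S+⋯+a_LS ⊄ E. -/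
noncomputable def LSE {p : ℕ} (S E : Finset (ZMod p)) : ℕ :=
  sInf {L : ℕ | ∀ a : Fin L → ZMod p, (∀ i, a i ≠ 0) → ¬ sumsetSub a S ⊆ E}

/-- β(p,S) = |S|^{-⌈(p-1)/(|S|-1)⌉}. -/
noncomputable def betaPS (p : ℕ) (S : Finset (ZMod p)) : ℝ :=
  ((S.card : ℝ) ^ ⌈((p : ℝ) - 1) / ((S.card : ℝ) - 1)⌉₊)⁻¹


lemma addChar_sum {p : ℕ} [Fact p.Prime] {ι : Type*} (e : AddChar (ZMod p) ℂ) (s : Finset ι)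
    (f : ι → ZMod p) : e (∑ i ∈ s, f i) = ∏ i ∈ s, e (f i) := by
  classical
  induction s using Finset.induction_on with
  | empty => simp
  | insert a s ha ih => rw [Finset.sum_insert ha, Finset.prod_insert ha, AddChar.map_add_eq_mul, ih]

lemma unit_norm_add_lt {a b : ℂ} (ha : ‖a‖ = 1) (hb : ‖b‖ = 1) (h : a ≠ b) : ‖a + b‖ < 2 := by
  have := (norm_midpoint_lt_iff (ha.trans hb.symm)).2 h
  rw [norm_smul, ha] at this
  norm_num at this
  linarith

lemma exists_bias {p : ℕ} [Fact p.Prime] (S : Finset (ZMod p)) (hS : 2 ≤ S.card) :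
    ∃ ρ : ℝ, 0 ≤ ρ ∧ ρ < 1 ∧ ∀ a : ZMod p, a ≠ 0 →
      ‖∑ v ∈ S, (ZMod.stdAddChar (a * v) : ℂ)‖ ≤ ρ * S.card := by
  classical
  have hs0 : (0 : ℝ) < S.card := by
    have : 0 < S.card := by omega
    exact_mod_cast this
  have key : ∀ a : ZMod p, a ≠ 0 → ‖∑ v ∈ S, (ZMod.stdAddChar (a * v) : ℂ)‖ < S.card := by
    intro a ha
    obtain ⟨u, hu, v, hv, huv⟩ := Finset.one_lt_card.1 (by omega : 1 < S.card)
    have hv' : v ∈ S.erase u := Finset.mem_erase.2 ⟨huv.symm, hv⟩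
    rw [← Finset.add_sum_erase S _ hu, ← Finset.add_sum_erase _ _ hv', ← add_assoc]
    have h1 : ‖(ZMod.stdAddChar (a * u) : ℂ) + ZMod.stdAddChar (a * v)‖ < 2 := by
      apply unit_norm_add_lt (AddChar.norm_apply _ _) (AddChar.norm_apply _ _)
      intro h
      have := ZMod.injective_stdAddChar h
      exact huv (mul_left_cancel₀ ha this)
    have h2 : ‖∑ w ∈ (S.erase u).erase v, (ZMod.stdAddChar (a * w) : ℂ)‖ ≤
        ((S.erase u).erase v).card := by
      refine (norm_sum_le _ _).trans ?_
      simp [AddChar.norm_apply]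
    have h3 : (((S.erase u).erase v).card : ℝ) = S.card - 2 := by
      rw [Finset.card_erase_of_mem hv', Finset.card_erase_of_mem hu, Nat.sub_sub,
        Nat.cast_sub hS]
      norm_num
    calc _ ≤ _ := norm_add_le _ _
      _ < 2 + (S.card - 2 : ℝ) := by linarith
      _ = _ := by ring
  have hne : (Finset.univ.filter fun a : ZMod p => a ≠ 0).Nonempty :=
    ⟨1, by simp⟩
  obtain ⟨b, hb, hmax⟩ := Finset.exists_max_image _
    (fun a : ZMod p => ‖∑ v ∈ S, (ZMod.stdAddChar (a * v) : ℂ)‖) hne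
  refine ⟨‖∑ v ∈ S, (ZMod.stdAddChar (b * v) : ℂ)‖ / S.card, by positivity, ?_, ?_⟩
  · rw [div_lt_one hs0]
    exact key b (by simpa using hb)
  · intro a ha
    rw [div_mul_cancel₀ _ hs0.ne']
    exact hmax a (by simpa using ha)

lemma fourier_count {p : ℕ} [Fact p.Prime] (S : Finset (ZMod p)) (hS : 2 ≤ S.card)
    {ρ : ℝ} (hρ0 : 0 ≤ ρ) (hρ1 : ρ < 1)
    (hρ : ∀ a : ZMod p, a ≠ 0 → ‖∑ v ∈ S, (ZMod.stdAddChar (a * v) : ℂ)‖ ≤ ρ * S.card)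
    {m n M : ℕ} (hM : (p : ℝ) ^ m * ρ ^ M ≤ 1) (f : Fin m → Fin n → ZMod p)
    (hf : ∀ l : Fin m → ZMod p, l ≠ 0 → M ≤ (supp fun z => ∑ j, l j * f j z).card)
    (y : Fin m → ZMod p) :
    (((Fintype.piFinset fun _ : Fin n => S).filter fun x => ∀ j, evalForm (f j) x = y j).card : ℝ)
      * (p : ℝ) ^ m ≤ 2 * (S.card : ℝ) ^ n := by
  classical
  set A := (Fintype.piFinset fun _ : Fin n => S) with hA
  have hs0 : (0 : ℝ) ≤ S.card := by positivity
  let e : AddChar (ZMod p) ℂ := ZMod.stdAddChar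
  have h1 : ∀ x : Fin n → ZMod p,
      ∑ l : Fin m → ZMod p, e (∑ j, l j * (evalForm (f j) x - y j)) =
        if (∀ j, evalForm (f j) x = y j) then (p : ℂ) ^ m else 0 := by
    intro x
    have := Finset.sum_prod_piFinset (Finset.univ : Finset (ZMod p))
      (fun (j : Fin m) (l : ZMod p) => e (l * (evalForm (f j) x - y j)))
    rw [Fintype.piFinset_univ] at this
    simp_rw [addChar_sum]
    rw [this]
    have hs : ∀ b : ZMod p, ∑ l, e (l * b) = ((if b = 0 then Fintype.card (ZMod p) else 0 : ℕ) : ℂ) :=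
      fun b => AddChar.sum_mulShift b (ZMod.isPrimitive_stdAddChar p)
    simp_rw [hs, sub_eq_zero]
    split_ifs with h
    · simp [h, ZMod.card]
    · push Not at h
      obtain ⟨j, hj⟩ := h
      exact Finset.prod_eq_zero (Finset.mem_univ j) (by simp [hj])
  have h2 : ((A.filter fun x => ∀ j, evalForm (f j) x = y j).card : ℂ) * (p : ℂ) ^ m =
      ∑ l : Fin m → ZMod p, ∑ x ∈ A, e (∑ j, l j * (evalForm (f j) x - y j)) := by
    rw [Finset.sum_comm]
    simp_rw [h1]
    rw [← Finset.sum_filter, Finset.sum_const, nsmul_eq_mul]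
  have h3 : ∀ l : Fin m → ZMod p, ‖∑ x ∈ A, e (∑ j, l j * (evalForm (f j) x - y j))‖ =
      ∏ z, ‖∑ v ∈ S, e ((∑ j, l j * f j z) * v)‖ := by
    intro l
    have : ∀ x : Fin n → ZMod p, e (∑ j, l j * (evalForm (f j) x - y j)) =
        e (- ∑ j, l j * y j) * ∏ z, e ((∑ j, l j * f j z) * x z) := by
      intro x
      rw [← addChar_sum, ← AddChar.map_add_eq_mul]
      congr 1
      simp only [mul_sub, Finset.sum_sub_distrib, evalForm, Finset.mul_sum, Finset.sum_mul]
      rw [Finset.sum_comm]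
      simp only [mul_assoc]
      ring
    simp_rw [this]
    rw [← Finset.mul_sum, norm_mul, AddChar.norm_apply, one_mul, hA,
      Finset.sum_prod_piFinset S (fun (z : Fin n) v => e ((∑ j, l j * f j z) * v)), norm_prod]
  have h4 : ∀ l : Fin m → ZMod p, l ≠ 0 →
      ‖∑ x ∈ A, e (∑ j, l j * (evalForm (f j) x - y j))‖ ≤ ρ ^ M * (S.card : ℝ) ^ n := by
    intro l hl
    rw [h3]
    calc _ ≤ ∏ z : Fin n, ((if z ∈ supp (fun z => ∑ j, l j * f j z) then ρ else 1) * (S.card : ℝ)) := by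
            apply Finset.prod_le_prod
            · intros; positivity
            · intro z _
              split_ifs with h
              · exact hρ _ (by simpa [supp] using h)
              · refine (norm_sum_le _ _).trans ?_
                simp [AddChar.norm_apply]
      _ = ρ ^ (supp (fun z => ∑ j, l j * f j z)).card * (S.card : ℝ) ^ n := by
            rw [Finset.prod_mul_distrib, Finset.prod_ite_mem, Finset.univ_inter]
            simp
      _ ≤ _ := by
            gcongr ?_ * _
            exact pow_le_pow_of_le_one hρ0 hρ1.le (hf l hl)
  have h5 : ‖∑ x ∈ A, e (∑ j, (0 : Fin m → ZMod p) j * (evalForm (f j) x - y j))‖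
      ≤ (S.card : ℝ) ^ n := by
    refine (norm_sum_le _ _).trans ?_
    simp [hA, Fintype.card_piFinset]
  have h6 := congrArg norm h2
  rw [norm_mul, norm_pow, Complex.norm_natCast, Complex.norm_natCast] at h6
  rw [h6, ← Finset.add_sum_erase _ _ (Finset.mem_univ (0 : Fin m → ZMod p))]
  refine (norm_add_le _ _).trans ?_
  have h7 : ‖∑ l ∈ (Finset.univ : Finset (Fin m → ZMod p)).erase 0,
      ∑ x ∈ A, e (∑ j, l j * (evalForm (f j) x - y j))‖ ≤ (p : ℝ) ^ m * (ρ ^ M * (S.card : ℝ) ^ n) := by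
    refine (norm_sum_le _ _).trans ?_
    refine (Finset.sum_le_card_nsmul _ _ (ρ ^ M * (S.card : ℝ) ^ n) ?_).trans ?_
    · intro l hl
      exact h4 l (Finset.ne_of_mem_erase hl)
    · rw [nsmul_eq_mul]
      gcongr
      have : ((Finset.univ : Finset (Fin m → ZMod p)).erase 0).card ≤ p ^ m := by
        refine (Finset.card_le_card (Finset.erase_subset _ _)).trans ?_
        simp [ZMod.card]
      exact_mod_cast this
  have h8 : (p : ℝ) ^ m * (ρ ^ M * (S.card : ℝ) ^ n) ≤ (S.card : ℝ) ^ n := by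
    rw [← mul_assoc]
    exact mul_le_of_le_one_left (by positivity) hM
  linarith

lemma dense_case {p : ℕ} [Fact p.Prime] (S : Finset (ZMod p)) (hS : 2 ≤ S.card)
    {ρ : ℝ} (hρ0 : 0 ≤ ρ) (hρ1 : ρ < 1)
    (hρ : ∀ a : ZMod p, a ≠ 0 → ‖∑ v ∈ S, (ZMod.stdAddChar (a * v) : ℂ)‖ ≤ ρ * S.card)
    {m n M r : ℕ} (hM : (p : ℝ) ^ m * ρ ^ M ≤ 1) (f : Fin m → Fin n → ZMod p)
    (hf : ∀ l : Fin m → ZMod p, l ≠ 0 → M ≤ (supp fun z => ∑ j, l j * f j z).card)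
    (E : Fin m → Finset (ZMod p)) (hE : ∀ i, (E i).card ≤ r) :
    (((Fintype.piFinset fun _ : Fin n => S).filter fun x => ∀ j, evalForm (f j) x ∈ E j).card : ℝ)
      ≤ 2 * ((r : ℝ) / p) ^ m * (S.card : ℝ) ^ n := by
  classical
  have hp0 : (0 : ℝ) < p := by exact_mod_cast (Fact.out : p.Prime).pos
  set A := (Fintype.piFinset fun _ : Fin n => S) with hA
  have hsub : (A.filter fun x => ∀ j, evalForm (f j) x ∈ E j) ⊆
      (Fintype.piFinset E).biUnion fun y => A.filter fun x => ∀ j, evalForm (f j) x = y j := by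
    intro x hx
    rw [Finset.mem_filter] at hx
    rw [Finset.mem_biUnion]
    refine ⟨fun j => evalForm (f j) x, Fintype.mem_piFinset.2 hx.2, ?_⟩
    rw [Finset.mem_filter]
    exact ⟨hx.1, fun _ => rfl⟩
  have h1 := (Finset.card_le_card hsub).trans Finset.card_biUnion_le
  have h2 : ((A.filter fun x => ∀ j, evalForm (f j) x ∈ E j).card : ℝ) ≤
      ∑ y ∈ Fintype.piFinset E, ((A.filter fun x => ∀ j, evalForm (f j) x = y j).card : ℝ) := by
    exact_mod_cast h1
  have h3 : ∀ y ∈ Fintype.piFinset E, ((A.filter fun x => ∀ j, evalForm (f j) x = y j).card : ℝ)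
      ≤ 2 * (S.card : ℝ) ^ n / (p : ℝ) ^ m := by
    intro y _
    rw [le_div_iff₀ (by positivity)]
    exact fourier_count S hS hρ0 hρ1 hρ hM f hf y
  refine h2.trans ((Finset.sum_le_card_nsmul _ _ _ h3).trans ?_)
  rw [nsmul_eq_mul]
  have h4 : ((Fintype.piFinset E).card : ℝ) ≤ (r : ℝ) ^ m := by
    have : (Fintype.piFinset E).card ≤ r ^ m := by
      rw [Fintype.card_piFinset]
      refine (Finset.prod_le_pow_card _ _ r (fun i _ => hE i)).trans ?_
      simp
    exact_mod_cast this
  calc _ ≤ (r : ℝ) ^ m * (2 * (S.card : ℝ) ^ n / (p : ℝ) ^ m) := by gcongr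
    _ = _ := by rw [div_pow]; ring


lemma sunflower {p : ℕ} [Fact p.Prime] {ι : Type*} [DecidableEq ι] {n : ℕ} (q M0 : ℕ) (hq : 1 ≤ q) :
    ∀ M : ℕ, M ≤ M0 → ∀ (I : Finset ι) (σ : ι → Fin n → ZMod p),
      (∀ i ∈ I, (supp (σ i)).card ≤ M) → (q * M0 * p + 1) ^ M * q ≤ I.card →
      ∃ J ⊆ I, q ≤ J.card ∧ ∃ τ : Fin n → ZMod p,
        (J : Set ι).PairwiseDisjoint fun i => supp (fun z => σ i z - τ z) := by
  classical
  intro M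
  induction M with
  | zero =>
    intro _ I σ hσ hI
    refine ⟨I, Finset.Subset.refl _, by simpa using hI, 0, ?_⟩
    intro i hi j hj hij
    have : supp (σ i) = ∅ := by
      rw [← Finset.card_eq_zero]
      have := hσ i hi
      omega
    simp [Function.onFun, this]
  | succ M ih =>
    intro hM I σ hσ hI
    have hne : (I.powerset.filter fun J : Finset ι =>
        (J : Set ι).PairwiseDisjoint fun i => supp (σ i)).Nonempty :=
      ⟨∅, by simp⟩
    obtain ⟨J, hJ⟩ := Finset.exists_maximal hne
    have hJ1 := hJ.prop
    rw [Finset.mem_filter, Finset.mem_powerset] at hJ1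
    by_cases hc : q ≤ J.card
    · exact ⟨J, hJ1.1, hc, 0, by simpa using hJ1.2⟩
    push Not at hc
    set U := J.biUnion fun i => supp (σ i) with hU
    have hUc : U.card ≤ q * M0 := by
      refine (Finset.card_biUnion_le_card_mul J _ (M + 1) fun i hi => hσ i (hJ1.1 hi)).trans ?_
      exact Nat.mul_le_mul hc.le hM
    have hmeet : ∀ i ∈ I \ J, ∃ z ∈ U, z ∈ supp (σ i) := by
      intro i hi
      rw [Finset.mem_sdiff] at hi
      by_contra hcon
      push Not at hcon
      have hins : insert i J ∈ (I.powerset.filter fun J : Finset ι =>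
        (J : Set ι).PairwiseDisjoint fun i => supp (σ i)) := by
        rw [Finset.mem_filter, Finset.mem_powerset]
        refine ⟨Finset.insert_subset hi.1 hJ1.1, ?_⟩
        rw [Finset.coe_insert]
        refine hJ1.2.insert ?_
        intro j hj _
        rw [Finset.disjoint_left]
        intro z hz hz'
        exact hcon z (Finset.mem_biUnion.2 ⟨j, hj, hz'⟩) hz
      have := hJ.le_of_ge hins (Finset.subset_insert i J)
      exact hi.2 (this (Finset.mem_insert_self i J))
    have hcard : (I \ J).card = I.card - J.card := Finset.card_sdiff_of_subset hJ1.1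
    have hJI := Finset.card_le_card hJ1.1
    have hW : 1 ≤ (q * M0 * p + 1) ^ M := Nat.one_le_pow _ _ (by omega)
    have hbig : q * M0 * p * ((q * M0 * p + 1) ^ M * q) ≤ (I \ J).card := by
      rw [hcard]
      have : (q * M0 * p + 1) ^ (M + 1) * q =
        q * M0 * p * ((q * M0 * p + 1) ^ M * q) + (q * M0 * p + 1) ^ M * q := by ring
      have h2 : q ≤ (q * M0 * p + 1) ^ M * q := Nat.le_mul_of_pos_left _ hW
      omega
    have hp0 : 0 < p := (Fact.out : p.Prime).pos
    have hIJ : (I \ J).Nonempty := by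
      rw [← Finset.card_pos]
      refine lt_of_lt_of_le ?_ hbig
      have : 0 < M0 := by omega
      positivity
    obtain ⟨i0, hi0⟩ := hIJ
    have : Nonempty (Fin n) := ⟨(hmeet i0 hi0).choose⟩
    choose! g hg1 hg2 using hmeet
    obtain ⟨⟨z, v⟩, hzv, hfib⟩ := Finset.exists_le_card_fiber_of_mul_le_card_of_maps_to
      (s := I \ J) (t := U ×ˢ (Finset.univ : Finset (ZMod p))) (f := fun i => (g i, σ i (g i)))
      (n := (q * M0 * p + 1) ^ M * q)
      (fun i hi => by simp [hg1 i hi]) ⟨(g i0, 0), by simp [hg1 i0 hi0]⟩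
      (by
        refine le_trans ?_ hbig
        rw [Finset.card_product, Finset.card_univ, ZMod.card]
        gcongr)
    obtain ⟨J', hJ', hJq, τ, hτ⟩ := ih (by omega)
      ((I \ J).filter fun i => (g i, σ i (g i)) = (z, v))
      (fun i w => σ i w - Pi.single (M := fun _ => ZMod p) z v w) (by
        intro i hi
        rw [Finset.mem_filter, Prod.mk.injEq] at hi
        obtain ⟨hi1, hi2, hi3⟩ := hi
        subst hi2
        have hlt : supp (fun w => σ i w - Pi.single (M := fun _ => ZMod p) (g i) v w) ⊆
            (supp (σ i)).erase (g i) := by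
          intro w hw
          simp only [supp, Finset.mem_filter, Finset.mem_univ, true_and, Finset.mem_erase] at hw ⊢
          by_cases hwg : w = g i
          · subst hwg
            simp [hi3] at hw
          · rw [Pi.single_eq_of_ne hwg, sub_zero] at hw
            exact ⟨hwg, hw⟩
        have h1 := Finset.card_le_card hlt
        rw [Finset.card_erase_of_mem (hg2 i hi1)] at h1
        have h2 := hσ i (Finset.mem_sdiff.1 hi1).1
        omega) hfib
    refine ⟨J', hJ'.trans ((Finset.filter_subset _ _).trans Finset.sdiff_subset), hJq,
      fun w => Pi.single (M := fun _ => ZMod p) z v w + τ w, ?_⟩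
    simpa only [sub_sub] using hτ

open scoped Pointwise in
lemma sumset_big {p : ℕ} [Fact p.Prime] (S : Finset (ZMod p)) (hS : 2 ≤ S.card) {n : ℕ}
    (ρ x : Fin n → ZMod p) (hx : ∀ i, x i ∈ S) (T : Finset (Fin n)) (hT : ∀ z ∈ T, ρ z ≠ 0) :
    min p (T.card * (S.card - 1) + 1) ≤
      (((Fintype.piFinset fun _ : Fin n => S).filter fun y => ∀ z ∉ T, y z = x z).image
        (evalForm ρ)).card := by
  classical
  induction T using Finset.induction_on with
  | empty =>
    have : 0 < (((Fintype.piFinset fun _ : Fin n => S).filter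
        fun y => ∀ z ∉ (∅ : Finset (Fin n)), y z = x z).image (evalForm ρ)).card := by
      rw [Finset.card_pos]
      exact ⟨_, Finset.mem_image_of_mem _ (a := x) (by simp [hx])⟩
    simp only [Finset.card_empty]
    omega
  | insert z T hz ih =>
    have ih := ih fun w hw => hT w (Finset.mem_insert_of_mem hw)
    set R := ((Fintype.piFinset fun _ : Fin n => S).filter fun y => ∀ z ∉ T, y z = x z).image
        (evalForm ρ) with hR
    set Q := S.image fun v => ρ z * (v - x z) with hQ
    have hρz := hT z (Finset.mem_insert_self _ _)
    have hQc : Q.card = S.card := Finset.card_image_of_injective _ fun a b h =>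
      sub_left_injective (mul_left_cancel₀ hρz h)
    have hRne : R.Nonempty := by
      rw [← Finset.card_pos]
      have := (Fact.out : p.Prime).pos
      omega
    have hQne : Q.Nonempty := by
      rw [← Finset.card_pos]; omega
    have hcd := ZMod.cauchy_davenport (Fact.out : p.Prime) hRne hQne
    have hsub : R + Q ⊆ ((Fintype.piFinset fun _ : Fin n => S).filter
        fun y => ∀ w ∉ insert z T, y w = x w).image (evalForm ρ) := by
      intro c hc
      obtain ⟨a, ha, b, hb, rfl⟩ := Finset.mem_add.1 hc
      obtain ⟨y, hy, rfl⟩ := Finset.mem_image.1 ha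
      obtain ⟨v, hv, rfl⟩ := Finset.mem_image.1 hb
      rw [Finset.mem_filter, Fintype.mem_piFinset] at hy
      refine Finset.mem_image.2 ⟨Function.update y z v, ?_, ?_⟩
      · rw [Finset.mem_filter, Fintype.mem_piFinset]
        constructor
        · intro w
          by_cases hw : w = z
          · subst hw; simpa using hv
          · simpa [hw] using hy.1 w
        · intro w hw
          rw [Finset.mem_insert, not_or] at hw
          simpa [hw.1] using hy.2 w hw.2
      · unfold evalForm
        rw [← Finset.add_sum_erase _ _ (Finset.mem_univ z),
          ← Finset.add_sum_erase _ (fun i => ρ i * y i) (Finset.mem_univ z),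
          Finset.sum_congr rfl (g := fun i => ρ i * y i)]
        · simp only [Function.update_self, hy.2 z hz]
          ring
        · intro w hw
          rw [Function.update_of_ne (Finset.ne_of_mem_erase hw)]
    have h3 := Finset.card_le_card hsub
    rw [Finset.card_insert_of_notMem hz]
    have h4 : (T.card + 1) * (S.card - 1) + 1 = T.card * (S.card - 1) + 1 + (S.card - 1) := by ring
    rw [h4]
    omega

lemma one_step {p : ℕ} [Fact p.Prime] (S : Finset (ZMod p)) (hS : 2 ≤ S.card) {n r L : ℕ}
    (hrp : r ≤ p - 1) (hL : r ≤ L * (S.card - 1))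
    (ρ : Fin n → ZMod p) (T : Finset (Fin n)) (hTL : T.card = L) (hT : ∀ z ∈ T, ρ z ≠ 0)
    (F : Finset (ZMod p)) (hF : F.card ≤ r)
    (A : Finset (Fin n → ZMod p)) (hA : ∀ x ∈ A, ∀ i, x i ∈ S)
    (hinv : ∀ x ∈ A, ∀ y : Fin n → ZMod p, (∀ i, y i ∈ S) → (∀ z ∉ T, y z = x z) → y ∈ A) :
    ((A.filter fun x => evalForm ρ x ∈ F).card : ℝ) ≤ (1 - ((S.card : ℝ) ^ L)⁻¹) * A.card := by
  classical
  have hp := (Fact.out : p.Prime).pos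
  have hex : ∀ x ∈ A, ∃ y : Fin n → ZMod p, (y ∈ A ∧ evalForm ρ y ∉ F) ∧ ∀ z ∉ T, y z = x z := by
    intro x hx
    have h1 := sumset_big S hS ρ x (hA x hx) T hT
    rw [hTL] at h1
    obtain ⟨c, hc, hcF⟩ := Finset.exists_mem_notMem_of_card_lt_card
      (lt_of_le_of_lt hF (lt_of_lt_of_le (by omega) h1))
    obtain ⟨y, hy, rfl⟩ := Finset.mem_image.1 hc
    rw [Finset.mem_filter, Fintype.mem_piFinset] at hy
    exact ⟨y, ⟨hinv x hx y hy.1 hy.2, hcF⟩, hy.2⟩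
  choose! g hg1 hg2 using hex
  have himg : A.image g ⊆ A.filter fun x => ¬ evalForm ρ x ∈ F := by
    intro y hy
    obtain ⟨x, hx, rfl⟩ := Finset.mem_image.1 hy
    exact Finset.mem_filter.2 (hg1 x hx)
  have hfib : A.card ≤ S.card ^ L * (A.image g).card := by
    apply Finset.card_le_mul_card_image
    intro y hy
    have : (A.filter fun a => g a = y).card ≤ (Fintype.piFinset fun _ : T => S).card := by
      apply Finset.card_le_card_of_injOn (fun x => fun t : T => x t)
      · intro x hx
        rw [Finset.mem_coe, Finset.mem_filter] at hx
        rw [Finset.mem_coe, Fintype.mem_piFinset]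
        exact fun t => hA x hx.1 t
      · intro x hx x' hx' h
        rw [Finset.mem_coe, Finset.mem_filter] at hx hx'
        funext z
        by_cases hz : z ∈ T
        · exact congrFun h ⟨z, hz⟩
        · rw [← hg2 x hx.1 z hz, ← hg2 x' hx'.1 z hz, hx.2, hx'.2]
    refine this.trans ?_
    simp [Fintype.card_piFinset, hTL]
  have h1 : A.card ≤ S.card ^ L * (A.filter fun x => ¬ evalForm ρ x ∈ F).card :=
    hfib.trans (Nat.mul_le_mul_left _ (Finset.card_le_card himg))
  have h2 := Finset.card_filter_add_card_filter_not (s := A) (fun x => evalForm ρ x ∈ F)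
  have h1' : (A.card : ℝ) ≤ (S.card : ℝ) ^ L * (A.filter fun x => ¬ evalForm ρ x ∈ F).card := by
    exact_mod_cast h1
  have h2' : ((A.filter fun x => evalForm ρ x ∈ F).card : ℝ) +
    (A.filter fun x => ¬ evalForm ρ x ∈ F).card = A.card := by exact_mod_cast h2
  have hs : (0 : ℝ) < (S.card : ℝ) ^ L := by
    have : 0 < S.card := by omega
    positivity
  have h3 : ((S.card : ℝ) ^ L)⁻¹ * A.card ≤ (A.filter fun x => ¬ evalForm ρ x ∈ F).card := by
    rw [inv_mul_le_iff₀ hs]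
    exact h1'
  linarith

lemma disjoint_case {p : ℕ} [Fact p.Prime] (S : Finset (ZMod p)) (hS : 2 ≤ S.card) {n r L : ℕ}
    (hrp : r ≤ p - 1) (hL : r ≤ L * (S.card - 1)) {ι : Type*} [DecidableEq ι]
    (ρ : ι → Fin n → ZMod p) (F : ι → Finset (ZMod p)) (hF : ∀ i, (F i).card ≤ r)
    (J : Finset ι) (hJL : ∀ i ∈ J, L ≤ (supp (ρ i)).card)
    (hJ : (J : Set ι).PairwiseDisjoint fun i => supp (ρ i)) :
    (((Fintype.piFinset fun _ : Fin n => S).filter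
      fun x => ∀ i ∈ J, evalForm (ρ i) x ∈ F i).card : ℝ) ≤
      (1 - ((S.card : ℝ) ^ L)⁻¹) ^ J.card * (S.card : ℝ) ^ n := by
  classical
  induction J using Finset.induction_on with
  | empty => simp [Fintype.card_piFinset]
  | insert j J hj ih =>
    have ih := ih (fun i hi => hJL i (Finset.mem_insert_of_mem hi))
      (hJ.subset (by simp))
    obtain ⟨T, hTs, hTc⟩ := Finset.exists_subset_card_eq (hJL j (Finset.mem_insert_self _ _))
    set A := (Fintype.piFinset fun _ : Fin n => S).filter
      fun x => ∀ i ∈ J, evalForm (ρ i) x ∈ F i with hA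
    have heq : ((Fintype.piFinset fun _ : Fin n => S).filter
      fun x => ∀ i ∈ insert j J, evalForm (ρ i) x ∈ F i) =
        A.filter fun x => evalForm (ρ j) x ∈ F j := by
      ext x
      simp only [hA, Finset.mem_filter, Finset.forall_mem_insert]
      tauto
    have h1 := one_step S hS hrp hL (ρ j) T hTc (fun z hz => by
        simpa [supp] using hTs hz) (F j) (hF j) A (fun x hx => by
          rw [hA, Finset.mem_filter, Fintype.mem_piFinset] at hx
          exact hx.1) (by
          intro x hx y hy hyx
          rw [hA, Finset.mem_filter, Fintype.mem_piFinset] at hx ⊢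
          refine ⟨hy, fun i hi => ?_⟩
          have : evalForm (ρ i) y = evalForm (ρ i) x := by
            unfold evalForm
            refine Finset.sum_congr rfl fun z _ => ?_
            by_cases hz : z ∈ T
            · have hij : i ≠ j := fun h => hj (h ▸ hi)
              have hd : Disjoint (supp (ρ i)) (supp (ρ j)) :=
                hJ (by simp [hi]) (by simp) hij
              have : z ∉ supp (ρ i) := fun h => Finset.disjoint_left.1 hd h (hTs hz)
              have : ρ i z = 0 := by simpa [supp] using this
              simp [this]
            · rw [hyx z hz]
          rw [this]
          exact hx.2 i hi)
    rw [heq, Finset.card_insert_of_notMem hj, pow_succ', mul_assoc]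
    refine h1.trans (mul_le_mul_of_nonneg_left ih ?_)
    have : (1 : ℝ) ≤ (S.card : ℝ) ^ L := by
      apply one_le_pow₀
      have : 1 ≤ S.card := by omega
      exact_mod_cast this
    have := inv_le_one_of_one_le₀ this
    linarith

lemma core {p : ℕ} [Fact p.Prime] (S : Finset (ZMod p)) (hS : 2 ≤ S.card)
    (r : ℕ) (hr1 : 1 ≤ r) (hrp : r ≤ p - 1)
    {ρ : ℝ} (hρ0 : 0 ≤ ρ) (hρ1 : ρ < 1)
    (hρ : ∀ a : ZMod p, a ≠ 0 → ‖∑ v ∈ S, (ZMod.stdAddChar (a * v) : ℂ)‖ ≤ ρ * S.card)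
    {θ : ℝ} (hθ1 : (r : ℝ) / p ≤ θ)
    (hθ2 : 1 - ((S.card : ℝ) ^ ((r - 1) / (S.card - 1) + 1))⁻¹ ≤ θ)
    {m M n k : ℕ} (hM : (p : ℝ) ^ m * ρ ^ M ≤ 1)
    (hk : p ^ m * (((m + 1) * M * p + 1) ^ M * (m + 1)) ≤ k)
    (E : Fin k → Finset (ZMod p)) (hE : ∀ i, (E i).card ≤ r)
    (φ : Fin k → Fin n → ZMod p)
    (hφ : ∀ i j : Fin k, i < j →
            2 * ((r - 1) / (S.card - 1)) + 1 ≤ (supp fun z => φ j z - φ i z).card) :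
    (((Fintype.piFinset fun _ : Fin n => S).filter
              fun x => ∀ i, evalForm (φ i) x ∈ E i).card : ℝ) ≤
      p * θ ^ m * (S.card : ℝ) ^ n := by
  classical
  have hpp := (Fact.out : p.Prime)
  have hp2 : (2 : ℝ) ≤ p := by exact_mod_cast hpp.two_le
  set L := (r - 1) / (S.card - 1) + 1 with hLdef
  have hL : r ≤ L * (S.card - 1) := by
    have := Nat.lt_div_mul_add (a := r - 1) (b := S.card - 1) (by omega)
    have h2 : L * (S.card - 1) = (r - 1) / (S.card - 1) * (S.card - 1) + (S.card - 1) := by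
      rw [hLdef]; ring
    omega
  let P : ℕ → Prop := fun d => ∃ i : Fin d → Fin k, ∀ l : Fin d → ZMod p, l ≠ 0 →
    M ≤ (supp fun z => ∑ j, l j * φ (i j) z).card
  by_cases hPm : P m
  · obtain ⟨i, hi⟩ := hPm
    have h1 := dense_case S hS hρ0 hρ1 hρ hM (fun j => φ (i j)) hi (fun j => E (i j))
      (fun j => hE (i j))
    have h2 : ((Fintype.piFinset fun _ : Fin n => S).filter
        fun x => ∀ i, evalForm (φ i) x ∈ E i) ⊆ ((Fintype.piFinset fun _ : Fin n => S).filter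
        fun x => ∀ j, evalForm (φ (i j)) x ∈ E (i j)) := by
      intro x hx
      rw [Finset.mem_filter] at hx ⊢
      exact ⟨hx.1, fun j => hx.2 (i j)⟩
    refine (Nat.cast_le.2 (Finset.card_le_card h2)).trans (h1.trans ?_)
    gcongr
  have hP0 : P 0 := ⟨Fin.elim0, fun l hl => absurd (Subsingleton.elim l 0) hl⟩
  obtain ⟨d, hdm, ⟨i, hi⟩, hPd⟩ : ∃ d < m, P d ∧ ¬ P (d + 1) := by
    by_contra hcon
    push Not at hcon
    have : ∀ d ≤ m, P d := by
      intro d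
      induction d with
      | zero => exact fun _ => hP0
      | succ d ih => exact fun h => hcon d (by omega) (ih (by omega))
    exact hPm (this m le_rfl)
  have happrox : ∀ t : Fin k, ∃ μ : Fin d → ZMod p,
      (supp fun z => φ t z - ∑ j, μ j * φ (i j) z).card ≤ M := by
    intro t
    by_contra hcon
    push Not at hcon
    apply hPd
    refine ⟨Fin.cons t i, fun l hl => ?_⟩
    simp only [Fin.sum_univ_succ, Fin.cons_zero, Fin.cons_succ]
    by_cases hl0 : l 0 = 0
    · simp only [hl0, zero_mul, zero_add]
      refine hi (fun j => l j.succ) fun h => hl ?_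
      funext j
      refine Fin.cases hl0 (fun j => ?_) j
      exact congrFun h j
    · refine (hcon fun j => -(l 0)⁻¹ * l j.succ).le.trans (le_of_eq ?_)
      congr 1
      ext z
      simp only [supp, Finset.mem_filter, Finset.mem_univ, true_and]
      have : l 0 * φ t z + ∑ j : Fin d, l j.succ * φ (i j) z =
          l 0 * (φ t z - ∑ j, -(l 0)⁻¹ * l j.succ * φ (i j) z) := by
        simp only [mul_assoc, ← Finset.mul_sum]
        field_simp
        ring
      rw [this]
      simp [hl0]
  choose μ hμ using happrox
  obtain ⟨μ0, _, hfib⟩ := Finset.exists_le_card_fiber_of_mul_le_card_of_maps_to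
    (s := (Finset.univ : Finset (Fin k))) (t := (Finset.univ : Finset (Fin d → ZMod p)))
    (f := μ) (n := ((m + 1) * M * p + 1) ^ M * (m + 1)) (fun _ _ => Finset.mem_univ _)
    ⟨0, Finset.mem_univ _⟩ (by
      rw [Finset.card_univ, Finset.card_univ, Fintype.card_fin, Fintype.card_fun, ZMod.card,
        Fintype.card_fin]
      refine le_trans ?_ hk
      gcongr
      exact hpp.pos)
  obtain ⟨J, hJI, hJm, τ, hJ⟩ := sunflower (p := p) (m + 1) M (by omega) M le_rfl _
    (fun t z => φ t z - ∑ j, μ0 j * φ (i j) z) (by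
      intro t ht
      rw [Finset.mem_filter] at ht
      rw [← ht.2]
      exact hμ t) hfib
  let ψ : Fin n → ZMod p := fun z => ∑ j, μ0 j * φ (i j) z + τ z
  let η : Fin k → Fin n → ZMod p := fun t z => φ t z - ψ z
  have hη : (J : Set (Fin k)).PairwiseDisjoint fun t => supp (η t) := by
    simpa only [sub_sub] using hJ
  have hdist : ∀ s t : Fin k, s ≠ t → 2 * (L - 1) + 1 ≤ (supp (η s) ∪ supp (η t)).card := by
    have key : ∀ s t : Fin k, s < t → 2 * (L - 1) + 1 ≤ (supp (η s) ∪ supp (η t)).card := by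
      intro s t hst
      refine (hφ s t hst).trans (Finset.card_le_card ?_)
      intro z hz
      simp only [supp, Finset.mem_filter, Finset.mem_univ, true_and, Finset.mem_union, η] at hz ⊢
      by_contra hcon
      push Not at hcon
      apply hz
      linear_combination hcon.2 - hcon.1
    intro s t hst
    rcases lt_or_gt_of_ne hst with h | h
    · exact key s t h
    · rw [Finset.union_comm]; exact key t s h
  set J' := J.filter fun t => L ≤ (supp (η t)).card with hJ'
  have hJ'c : m ≤ J'.card := by
    have h1 : J'.card + (J.filter fun t => ¬ L ≤ (supp (η t)).card).card = J.card := by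
      rw [hJ']
      convert Finset.card_filter_add_card_filter_not (s := J) (fun t => L ≤ (supp (η t)).card)
    have h2 : (J.filter fun t => ¬ L ≤ (supp (η t)).card).card ≤ 1 := by
      rw [Finset.card_le_one]
      intro s hs t ht
      by_contra hst
      rw [Finset.mem_filter] at hs ht
      have h3 := hdist s t hst
      have h4 := Finset.card_union_le (supp (η s)) (supp (η t))
      omega
    omega
  have hsub : ((Fintype.piFinset fun _ : Fin n => S).filter
        fun x => ∀ i, evalForm (φ i) x ∈ E i) ⊆ (Finset.univ : Finset (ZMod p)).biUnion
        fun u => ((Fintype.piFinset fun _ : Fin n => S).filter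
        fun x => ∀ t ∈ J', evalForm (η t) x ∈ (E t).image fun v => v - u) := by
    intro x hx
    rw [Finset.mem_filter] at hx
    rw [Finset.mem_biUnion]
    refine ⟨evalForm ψ x, Finset.mem_univ _, ?_⟩
    rw [Finset.mem_filter]
    refine ⟨hx.1, fun t _ => Finset.mem_image.2 ⟨_, hx.2 t, ?_⟩⟩
    simp only [evalForm, η, sub_mul, Finset.sum_sub_distrib]
  have h1 := (Finset.card_le_card hsub).trans Finset.card_biUnion_le
  have hb0 : (0 : ℝ) ≤ 1 - ((S.card : ℝ) ^ L)⁻¹ := by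
    have : (1 : ℝ) ≤ (S.card : ℝ) ^ L := by
      apply one_le_pow₀
      have : 1 ≤ S.card := by omega
      exact_mod_cast this
    have := inv_le_one_of_one_le₀ this
    linarith
  have hb1 : 1 - ((S.card : ℝ) ^ L)⁻¹ ≤ 1 := by
    have : (0 : ℝ) ≤ ((S.card : ℝ) ^ L)⁻¹ := by positivity
    linarith
  have h2 : ∀ u ∈ (Finset.univ : Finset (ZMod p)),
      (((Fintype.piFinset fun _ : Fin n => S).filter
        fun x => ∀ t ∈ J', evalForm (η t) x ∈ (E t).image fun v => v - u).card : ℝ) ≤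
        θ ^ m * (S.card : ℝ) ^ n := by
    intro u _
    have h := (disjoint_case S hS hrp hL η (fun t => (E t).image fun v => v - u)
      (fun t => Finset.card_image_le.trans (hE t)) J' (fun t ht => (Finset.mem_filter.1 ht).2)
      (hη.subset (Finset.coe_subset.2 (Finset.filter_subset _ _))))
    refine le_trans (le_of_eq ?_) (h.trans ?_)
    · congr!
    gcongr ?_ * _
    exact (pow_le_pow_of_le_one hb0 hb1 hJ'c).trans (pow_le_pow_left₀ hb0 hθ2 m)
  have h3 : (((Fintype.piFinset fun _ : Fin n => S).filter
        fun x => ∀ i, evalForm (φ i) x ∈ E i).card : ℝ) ≤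
      ∑ u : ZMod p, (((Fintype.piFinset fun _ : Fin n => S).filter
        fun x => ∀ t ∈ J', evalForm (η t) x ∈ (E t).image fun v => v - u).card : ℝ) := by
    exact_mod_cast h1
  refine h3.trans ((Finset.sum_le_card_nsmul _ _ _ h2).trans (le_of_eq ?_))
  rw [nsmul_eq_mul, Finset.card_univ, ZMod.card, mul_assoc]

lemma numerics {p D m : ℕ} (hp : 2 ≤ p) (hD : 1 ≤ D) (hm : 1 ≤ m) :
    p ^ m * (((m + 1) * (D * m) * p + 1) ^ (D * m) * (m + 1)) ≤
      ((3 * D * p) * m) ^ ((3 * D * p) * m) := by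
  set X := 3 * D * p * m with hX
  have hDpm : 1 ≤ D * p * m := Nat.mul_pos (Nat.mul_pos hD (by omega)) hm
  have hX3 : X = 3 * (D * p * m) := by rw [hX]; ring
  have hpX : p ≤ X := by
    have : p ≤ D * p * m := by
      calc p = 1 * p * 1 := by ring
        _ ≤ D * p * m := by gcongr
    omega
  have hmX : 2 * m ≤ X := by
    have : m ≤ D * p * m := by
      calc m = 1 * 1 * m := by ring
        _ ≤ D * p * m := by gcongr; omega
    omega
  have h1 : (m + 1) * (D * m) * p + 1 ≤ X ^ 2 := by
    have e1 : (m + 1) * (D * m) * p ≤ 2 * m * (D * p * m) := by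
      calc (m + 1) * (D * m) * p ≤ (2 * m) * (D * m) * p := by gcongr; omega
        _ = _ := by ring
    nlinarith
  have hX1 : 1 ≤ X := by omega
  calc p ^ m * (((m + 1) * (D * m) * p + 1) ^ (D * m) * (m + 1))
      ≤ X ^ m * ((X ^ 2) ^ (D * m) * X ^ 1) := by
        gcongr
        rw [pow_one]
        omega
    _ = X ^ (m + (2 * (D * m) + 1)) := by
        rw [← pow_mul, ← pow_add, ← pow_add]
    _ ≤ X ^ X := by
        apply Nat.pow_le_pow_right hX1
        have e2 : m ≤ D * m := Nat.le_mul_of_pos_left _ hD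
        have e3 : 2 * (D * m) ≤ D * p * m := by
          calc 2 * (D * m) ≤ p * (D * m) := by gcongr
            _ = _ := by ring
        omega

lemma analysis {θ : ℝ} (h0 : 0 < θ) (h1 : θ < 1) {B : ℕ} (hB : 1 ≤ B) {p : ℝ} (hp : 1 ≤ p) :
    ∃ a C : ℝ, 0 < a ∧ 0 < C ∧ ∀ k : ℕ, 3 ≤ k → ∀ δ : ℝ, δ ≤ 1 →
      (∀ m : ℕ, 1 ≤ m → (B * m) ^ (B * m) ≤ k → δ ≤ p * θ ^ m) →
      δ ≤ C * (k : ℝ) ^ (-(a / Real.log (Real.log k))) := by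
  have hlog : Real.log θ < 0 := Real.log_neg h0 h1
  have hB' : (0 : ℝ) < B := by exact_mod_cast hB
  set a := -Real.log θ / B with ha
  have ha0 : 0 < a := div_pos (by linarith) hB'
  set g := Real.log (Real.log 3) with hg
  have h3 : 1 < Real.log 3 := by
    rw [Real.lt_log_iff_exp_lt (by norm_num)]
    exact Real.exp_one_lt_d9.trans (by norm_num)
  have hg0 : 0 < g := Real.log_pos h3
  refine ⟨a, p * θ⁻¹ + Real.exp (a * Real.exp 1 / g), ha0, by positivity, ?_⟩
  intro k hk δ hδ hyp
  have hk3 : (3 : ℝ) ≤ k := by exact_mod_cast hk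
  have hk0 : (0 : ℝ) < k := by linarith
  set K := Real.log k with hK
  have hK3 : Real.log 3 ≤ K := Real.log_le_log (by norm_num) hk3
  have hK1 : 1 < K := by linarith
  have hK0 : 0 < K := by linarith
  set G := Real.log K with hG
  have hGg : g ≤ G := Real.log_le_log (by linarith) hK3
  have hG0 : 0 < G := by linarith
  have hKG : Real.exp G = K := Real.exp_log hK0
  rw [Real.rpow_def_of_pos hk0, ← hK]
  have hpos := Real.exp_pos (K * -(a / G))
  rw [add_mul]
  have hA : 0 ≤ p * θ⁻¹ * Real.exp (K * -(a / G)) := by positivity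
  rcases lt_or_ge G 1 with hG1 | hG1
  · have : 1 ≤ Real.exp (a * Real.exp 1 / g) * Real.exp (K * -(a / G)) := by
      rw [← Real.exp_add]
      apply Real.one_le_exp
      have hKe : K ≤ Real.exp 1 := by
        rw [← hKG]; exact Real.exp_le_exp.2 hG1.le
      have : a * K / G ≤ a * Real.exp 1 / g := by gcongr
      have e : K * -(a / G) = - (a * K / G) := by ring
      rw [e]; linarith
    linarith
  · have hE : 0 ≤ Real.exp (a * Real.exp 1 / g) * Real.exp (K * -(a / G)) := by positivity
    set m := ⌊K / (B * G)⌋₊ with hm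
    have hm1 : (m : ℝ) ≤ K / (B * G) := Nat.floor_le (by positivity)
    have hm2 : K / (B * G) < m + 1 := Nat.lt_floor_add_one _
    have hδm : δ ≤ p * θ ^ m := by
      rcases Nat.eq_zero_or_pos m with hm0 | hm0
      · rw [hm0]; simpa using hδ.trans hp
      · apply hyp m hm0
        have hm0' : (1 : ℝ) ≤ m := by exact_mod_cast hm0
        have hBm : (B : ℝ) * m ≤ K / G := by
          calc (B : ℝ) * m ≤ B * (K / (B * G)) := by gcongr
            _ = K / G := by field_simp
        have hBm0 : 0 < (B : ℝ) * m := by positivity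
        have hBmK : (B : ℝ) * m ≤ K := hBm.trans (div_le_self hK0.le hG1)
        have : (((B * m) ^ (B * m) : ℕ) : ℝ) ≤ k := by
          push_cast
          rw [← Real.rpow_natCast, Real.rpow_def_of_pos hBm0]
          rw [← Real.exp_log hk0, ← hK]
          apply Real.exp_le_exp.2
          push_cast
          have hl : Real.log (B * m) ≤ G := Real.log_le_log hBm0 hBmK
          calc Real.log (B * m) * (B * m) ≤ G * (B * m) := by gcongr
            _ ≤ G * (K / G) := by gcongr
            _ = K := by field_simp
        exact_mod_cast this
    have hθm : θ ^ m ≤ θ⁻¹ * Real.exp (K * -(a / G)) := by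
      rw [← Real.exp_log h0, ← Real.exp_neg, ← Real.exp_nat_mul, ← Real.exp_add]
      apply Real.exp_le_exp.2
      have e : K * -(a / G) = K / (B * G) * Real.log θ := by
        rw [ha]; field_simp
      rw [e]
      nlinarith
    have : p * θ ^ m ≤ p * θ⁻¹ * Real.exp (K * -(a / G)) := by
      rw [mul_assoc]; gcongr
    linarith

theorem stmt_5 {p : ℕ} (hp : p.Prime) [NeZero p] (S : Finset (ZMod p)) (hS : 2 ≤ S.card)
    (r : ℕ) (hr1 : 1 ≤ r) (hrp : r ≤ p - 1) :
    ∃ a C : ℝ, 0 < a ∧ 0 < C ∧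
      ∀ n k : ℕ, 3 ≤ k →
        ∀ E : Fin k → Finset (ZMod p), (∀ i, E i ⊂ Finset.univ) → (∀ i, (E i).card ≤ r) →
        ∀ φ : Fin k → Fin n → ZMod p,
          (∀ i j : Fin k, i < j →
            2 * ((r - 1) / (S.card - 1)) + 1 ≤ (supp fun z => φ j z - φ i z).card) →
          (((Fintype.piFinset fun _ : Fin n => S).filter
              fun x => ∀ i, evalForm (φ i) x ∈ E i).card : ℝ) / (S.card : ℝ) ^ n
            ≤ C * (k : ℝ) ^ (-(a / Real.log (Real.log k))) := by
  have : Fact p.Prime := ⟨hp⟩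
  obtain ⟨ρ, hρ0, hρ1, hρ⟩ := exists_bias S hS
  have hp2 : (2 : ℝ) ≤ p := by exact_mod_cast hp.two_le
  have hp0 : (0 : ℝ) < p := by linarith
  have hs0 : (0 : ℝ) < S.card := by
    have : 0 < S.card := by omega
    exact_mod_cast this
  obtain ⟨D, hD, hD1⟩ : ∃ D : ℕ, (p : ℝ) * ρ ^ D ≤ 1 ∧ 1 ≤ D := by
    obtain ⟨D, hD⟩ := exists_pow_lt_of_lt_one (inv_pos.2 hp0) hρ1
    refine ⟨D + 1, ?_, by omega⟩
    have h1 : ρ ^ (D + 1) ≤ ρ ^ D := pow_le_pow_of_le_one hρ0 hρ1.le (by omega)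
    calc (p : ℝ) * ρ ^ (D + 1) ≤ p * (p : ℝ)⁻¹ := by gcongr; linarith
      _ = 1 := mul_inv_cancel₀ hp0.ne'
  set L := (r - 1) / (S.card - 1) + 1 with hL
  set θ : ℝ := max ((r : ℝ) / p) (1 - ((S.card : ℝ) ^ L)⁻¹) with hθ
  have hr0 : (0 : ℝ) < r := by exact_mod_cast hr1
  have hθ0 : 0 < θ := lt_max_of_lt_left (by positivity)
  have hθ1 : θ < 1 := by
    apply max_lt
    · rw [div_lt_one hp0]
      have := hp.two_le
      have : r < p := by omega
      exact_mod_cast this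
    · have : 0 < ((S.card : ℝ) ^ L)⁻¹ := by positivity
      linarith
  have hB : 1 ≤ 3 * D * p := Nat.mul_pos (by omega) hp.pos
  obtain ⟨a, C, ha, hC, hmain⟩ := analysis hθ0 hθ1 hB (p := (p : ℝ)) (by linarith)
  refine ⟨a, C, ha, hC, ?_⟩
  intro n k hk E _ hE φ hφ
  apply hmain k hk
  · rw [div_le_one (by positivity)]
    have := Finset.card_filter_le (Fintype.piFinset fun _ : Fin n => S)
      (fun x => ∀ i, evalForm (φ i) x ∈ E i)
    rw [Fintype.card_piFinset] at this
    simp only [Finset.prod_const, Finset.card_univ, Fintype.card_fin] at this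
    exact_mod_cast this
  · intro m hm hmk
    rw [div_le_iff₀ (by positivity)]
    refine core S hS r hr1 hrp hρ0 hρ1 hρ (le_max_left _ _) (le_max_right _ _) (M := D * m) ?_
      ((numerics hp.two_le hD1 hm).trans hmk) E hE φ hφ
    rw [pow_mul, ← mul_pow]
    exact pow_le_one₀ (by positivity) hD
end

section
/- Let p ≥ 3 be a prime, let r ≥ 1 be an integer, set q = (p−1)/2 and k = ⌈r/q⌉. Then there exist n (one may take n = 2kq) and mod-p forms φ₁, …, φ_k, φ : 𝔽_p^n → 𝔽_p such that: (i) |Z(φ − (a₁φ₁ + ⋯ + a_kφ_k))| ≥ r for every (a₁, …, a_k) ∈ 𝔽_p^k; and (ii) every x ∈ {0,1}^n with φ₁(x) = 0, …, φ_k(x) = 0 satisfies φ(x) = 0. In particular, the condition φ(x) ∈ {0} is implied by the conditions φ_i(x) ∈ {0} even though φ is r-separated from the span of φ₁, …, φ_k. -/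
open Finset

theorem stmt_12 {p : ℕ} (hp : p.Prime) (hp3 : 3 ≤ p) (r : ℕ) (hr : 1 ≤ r)
    (q k : ℕ) (hq : q = (p - 1) / 2) (hk : k = (r + q - 1) / q) :
    ∃ (n : ℕ) (φs : Fin k → Fin n → ZMod p) (φ : Fin n → ZMod p),
      (∀ a : Fin k → ZMod p,
        r ≤ (supp fun z => φ z - ∑ i, a i * φs i z).card) ∧
      ∀ x : Fin n → ZMod p, (∀ z, x z = 0 ∨ x z = 1) →
        (∀ i, evalForm (φs i) x = 0) → evalForm φ x = 0 := by
  haveI : Fact p.Prime := ⟨hp⟩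
  have hq1 : 1 ≤ q := by omega
  have hqp : q * 2 < p := by omega
  have hkq : r ≤ k * q := by
    have h1 := Nat.div_add_mod (r + q - 1) q
    have h2 := Nat.mod_lt (r + q - 1) hq1
    rw [← hk] at h1
    rw [mul_comm k q]
    omega
  let e := (Fintype.equivFin (Fin k × Fin q × Bool)).symm
  refine ⟨_, fun i z => if (e z).1 = i then 1 else 0,
    fun z => if (e z).2.2 = true then 1 else 0, ?_, ?_⟩
  · intro a
    refine hkq.trans ?_
    classical
    let f : Fin k × Fin q → Fin (Fintype.card (Fin k × Fin q × Bool)) :=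
      fun ij => e.symm (ij.1, ij.2, if a ij.1 = 1 then false else true)
    have hf : Function.Injective f := by
      rintro ⟨i, j⟩ ⟨i', j'⟩ h
      have := e.symm.injective h
      simp only [Prod.mk.injEq] at this
      simp [this.1, this.2.1]
    have hc : (Finset.univ.image f).card = k * q := by
      rw [Finset.card_image_of_injective _ hf]; simp
    rw [← hc]
    apply Finset.card_le_card
    intro z hz
    obtain ⟨⟨i, j⟩, -, rfl⟩ := Finset.mem_image.mp hz
    simp only [supp, Finset.mem_filter, Finset.mem_univ, true_and, f, Equiv.apply_symm_apply]
    by_cases h : a i = 1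
    · simp [h]
    · simp [h, sub_eq_zero, Ne.symm h]
  · intro x hx h
    have hz : ∀ z, x z = 0 := by
      intro z
      by_contra hne
      have hi := h (e z).1
      have hs : evalForm (fun w => if (e w).1 = (e z).1 then (1 : ZMod p) else 0) x
          = ((Finset.univ.filter fun w => (e w).1 = (e z).1 ∧ x w = 1).card : ZMod p) := by
        rw [evalForm, Finset.card_filter, Nat.cast_sum]
        refine Finset.sum_congr rfl fun w _ => ?_
        by_cases h1 : (e w).1 = (e z).1 <;> rcases hx w with h2 | h2 <;> simp [h1, h2]
      rw [hs, ZMod.natCast_eq_zero_iff] at hi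
      have hle : (Finset.univ.filter fun w => (e w).1 = (e z).1 ∧ x w = 1).card ≤ q * 2 := by
        have : (Finset.univ : Finset (Fin q × Bool)).card = q * 2 := by simp
        rw [← this]
        refine Finset.card_le_card_of_injOn (fun w => (e w).2) (by simp) ?_
        intro w hw w' hw' hww
        simp only [Finset.coe_filter, Finset.mem_univ, true_and, Set.mem_setOf_eq] at hw hw'
        exact e.injective (Prod.ext (hw.1.trans hw'.1.symm) hww)
      have hpos : 0 < (Finset.univ.filter fun w => (e w).1 = (e z).1 ∧ x w = 1).card :=
        Finset.card_pos.mpr ⟨z, by simp [(hx z).resolve_left hne]⟩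
      exact absurd (Nat.le_of_dvd hpos hi) (by omega)
    simp [evalForm, hz]
end
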